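/- There exists a bounded linear operator T : ℓ₂ ⊗̂_ε ℓ₂ → ℓ₂ which is 2-summing but not 1-summing, and whose associated operator T# : ℓ₂ → Π₁(ℓ₂, ℓ₂) is 1-summing. -/

import Mathlib

set_option maxHeartbeats 1000000
set_option synthInstance.maxHeartbeats 400000
set_option maxSynthPendingDepth 3

noncomputable section

open scoped BigOperators NNReal ENNReal
open NormedSpace

/-- The scalar field. -/
notation "𝕂" => ℝ

section Summing

variable {E F : Type} [NormedAddCommGroup E] [NormedSpace 𝕂 E]
  [NormedAddCommGroup F] [NormedSpace 𝕂 F]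

/-- The weak ℓ_q norm of a finite family of vectors:
`sup { (Σ_i ‖e*(e_i)‖^q)^(1/q) : e* ∈ E*, ‖e*‖ ≤ 1 }`. -/
def weakNorm (q : ℝ) {n : ℕ} (e : Fin n → E) : ℝ :=
  ⨆ f : {f : StrongDual 𝕂 E // ‖f‖ ≤ 1}, (∑ i, ‖(f : StrongDual 𝕂 E) (e i)‖ ^ q) ^ (1 / q)

/-- `T` satisfies the (p,q)-summing inequality with constant `C`:
`(Σ_i ‖T e_i‖^p)^(1/p) ≤ C · sup { (Σ_i ‖e*(e_i)‖^q)^(1/q) : ‖e*‖ ≤ 1 }`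
for all finite families `e_1, …, e_n`. -/
def SummingWithC (p q C : ℝ) (T : E →L[𝕂] F) : Prop :=
  ∀ (n : ℕ) (e : Fin n → E),
    (∑ i, ‖T (e i)‖ ^ p) ^ (1 / p) ≤ C * weakNorm q e

/-- `T` is (p,q)-summing. -/
def IsPQSumming (p q : ℝ) (T : E →L[𝕂] F) : Prop :=
  ∃ C, 0 ≤ C ∧ SummingWithC p q C T

/-- `T` is p-summing. -/
def IsPSumming (p : ℝ) (T : E →L[𝕂] F) : Prop := IsPQSumming p p T

/-- The p-summing norm `π_p(T)`: the least admissible constant. -/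
def pNorm (p : ℝ) (T : E →L[𝕂] F) : ℝ :=
  sInf {C | 0 ≤ C ∧ SummingWithC p p C T}

end Summing

section Eps

variable {X Y : Type} [NormedAddCommGroup X] [NormedSpace 𝕂 X]
  [NormedAddCommGroup Y] [NormedSpace 𝕂 Y]

/-- The rank-one operator `x* ↦ x*(x) • y`, realizing the elementary tensor `x ⊗ y`
inside the space of operators from `X*` to `Y`. -/
def elemTensor (x : X) (y : Y) : StrongDual 𝕂 X →L[𝕂] Y :=
  (inclusionInDoubleDual 𝕂 X x).smulRight y

/-- The injective tensor product `X ⊗̂_ε Y`, as a submodule of the operators `X* → Y`: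
the closure of the span of the elementary tensors.  (The operator norm of
`x* ↦ Σ_i x*(x_i) • y_i` is exactly the injective tensor norm of `Σ_i x_i ⊗ y_i`.) -/
def epsSub (X Y : Type) [NormedAddCommGroup X] [NormedSpace 𝕂 X]
    [NormedAddCommGroup Y] [NormedSpace 𝕂 Y] : Submodule 𝕂 (StrongDual 𝕂 X →L[𝕂] Y) :=
  (Submodule.span 𝕂 (Set.range fun p : X × Y => elemTensor p.1 p.2)).topologicalClosure

/-- The injective tensor product `X ⊗̂_ε Y` as a normed space. -/
def EpsTensor (X Y : Type) [NormedAddCommGroup X] [NormedSpace 𝕂 X]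
    [NormedAddCommGroup Y] [NormedSpace 𝕂 Y] : Type := ↥(epsSub X Y)

instance : NormedAddCommGroup (EpsTensor X Y) :=
  inferInstanceAs (NormedAddCommGroup ↥(epsSub X Y))

instance : NormedSpace 𝕂 (EpsTensor X Y) :=
  inferInstanceAs (NormedSpace 𝕂 ↥(epsSub X Y))

instance [CompleteSpace Y] : CompleteSpace (EpsTensor X Y) := by
  have h : IsClosed ((epsSub X Y : Submodule 𝕂 (StrongDual 𝕂 X →L[𝕂] Y)) : Set (StrongDual 𝕂 X →L[𝕂] Y)) := by
    unfold epsSub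
    exact Submodule.isClosed_topologicalClosure _
  exact h.completeSpace_coe

/-- The elementary tensor `x ⊗ y` as an element of `X ⊗̂_ε Y`. -/
def tmulEps (x : X) (y : Y) : EpsTensor X Y :=
  show ↥(epsSub X Y) from
    ⟨elemTensor x y,
      Submodule.le_topologicalClosure _ (Submodule.subset_span ⟨(x, y), rfl⟩)⟩

/-- For fixed `x : X`, the bounded linear map `y ↦ x ⊗ y` from `Y` to `X ⊗̂_ε Y`. -/
def tmulLeft (x : X) : Y →L[𝕂] EpsTensor X Y :=
  show Y →L[𝕂] ↥(epsSub X Y) from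
    ContinuousLinearMap.codRestrict
      (ContinuousLinearMap.smulRightL 𝕂 (StrongDual 𝕂 X) Y (inclusionInDoubleDual 𝕂 X x))
      (epsSub X Y)
      (fun y => Submodule.le_topologicalClosure _ (Submodule.subset_span ⟨(x, y), rfl⟩))

variable {Z : Type} [NormedAddCommGroup Z] [NormedSpace 𝕂 Z]

/-- The operator `T# x : Y → Z` induced by `T : X ⊗̂_ε Y → Z`, i.e. `(T# x) y = T (x ⊗ y)`. -/
def sharp (T : EpsTensor X Y →L[𝕂] Z) (x : X) : Y →L[𝕂] Z :=
  T.comp (tmulLeft x)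

end Eps

section Integral

variable {E F : Type} [NormedAddCommGroup E] [NormedSpace 𝕂 E]
  [NormedAddCommGroup F] [NormedSpace 𝕂 F]

/-- `Φ ∈ (E ⊗̂_ε F*)*` extends the bilinear form `(e, f) ↦ f (T e)` associated to `T`. -/
def ExtendsOf (T : E →L[𝕂] F) (Φ : StrongDual 𝕂 (EpsTensor E (StrongDual 𝕂 F))) : Prop :=
  ∀ (e : E) (f : StrongDual 𝕂 F), Φ (tmulEps e f) = f (T e)

/-- `T : E → F` is an integral operator: the bilinear form `(e, f) ↦ f(T e)` extends to a
bounded linear functional on `E ⊗̂_ε F*`. -/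
def IsIntegralOp (T : E →L[𝕂] F) : Prop := ∃ Φ, ExtendsOf T Φ

/-- The integral norm `‖T‖_int` of `T`: the norm of the extending functional
(the extension is unique, since the elementary tensors span a dense subspace). -/
def integralNorm (T : E →L[𝕂] F) : ℝ :=
  sInf {c | ∃ Φ, ExtendsOf T Φ ∧ ‖Φ‖ = c}

end Integral

section IntegralSpace

variable (Y Z : Type) [NormedAddCommGroup Y] [NormedSpace 𝕂 Y]
  [NormedAddCommGroup Z] [NormedSpace 𝕂 Z]

/-- The space `I(Y,Z)` of integral operators from `Y` to `Z` with the integral norm,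
realized isometrically as the subspace of `(Y ⊗̂_ε Z*)*` consisting of those functionals
that extend the bilinear form of a (necessarily unique) operator `T : Y → Z`. -/
def IntegralSub : Submodule 𝕂 (StrongDual 𝕂 (EpsTensor Y (StrongDual 𝕂 Z))) where
  carrier := {Φ | ∃ T : Y →L[𝕂] Z, ExtendsOf T Φ}
  add_mem' := by
    rintro Φ Ψ ⟨T, hT⟩ ⟨S, hS⟩
    exact ⟨T + S, fun e f => by
      simp [ExtendsOf, ContinuousLinearMap.add_apply, map_add, hT e f, hS e f]⟩
  zero_mem' := ⟨0, fun e f => by simp⟩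
  smul_mem' := by
    rintro c Φ ⟨T, hT⟩
    exact ⟨c • T, fun e f => by
      simp [ContinuousLinearMap.smul_apply, map_smul, hT e f]⟩

/-- The space `I(Y,Z)` of integral operators with the integral norm, as a normed space. -/
def IntegralSpace : Type := ↥(IntegralSub Y Z)

instance : NormedAddCommGroup (IntegralSpace Y Z) :=
  inferInstanceAs (NormedAddCommGroup ↥(IntegralSub Y Z))

instance : NormedSpace 𝕂 (IntegralSpace Y Z) :=
  inferInstanceAs (NormedSpace 𝕂 ↥(IntegralSub Y Z))

variable {Y Z}

/-- The functional in `(Y ⊗̂_ε Z*)*` underlying an element of `I(Y,Z)`. -/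
def IntegralSpace.toFunctional (Φ : IntegralSpace Y Z) : StrongDual 𝕂 (EpsTensor Y (StrongDual 𝕂 Z)) :=
  (show ↥(IntegralSub Y Z) from Φ).1

end IntegralSpace

abbrev eps (t : Finset ℕ) (k : ℕ) : ℝ := if k ∈ t then 1 else -1
lemma rad_mom (a : ℕ → ℝ) (N : ℕ) :
    (∑ t ∈ (Finset.range N).powerset, (∑ k ∈ Finset.range N, eps t k * a k)^2 = 2^N * ∑ k ∈ Finset.range N, a k ^2) ∧
    (∑ t ∈ (Finset.range N).powerset, (∑ k ∈ Finset.range N, eps t k * a k)^4 ≤ 2^N * (3 * (∑ k ∈ Finset.range N, a k ^2)^2)) := by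
  induction N with
  | zero => simp
  | succ N ih =>
    obtain ⟨h2, h4⟩ := ih
    have key : ∀ g : ℝ → ℝ, ∑ t ∈ (Finset.range (N+1)).powerset, g (∑ k ∈ Finset.range (N+1), eps t k * a k)
        = ∑ t ∈ (Finset.range N).powerset, (g (∑ k ∈ Finset.range N, eps t k * a k - a N) +
            g (∑ k ∈ Finset.range N, eps t k * a k + a N)) := by
      intro g
      rw [Finset.range_add_one, Finset.sum_powerset_insert (by simp), Finset.sum_add_distrib]
      congr 1
      · apply Finset.sum_congr rfl
        intro t ht
        have hN : N ∉ t := fun h => by simpa using Finset.mem_powerset.1 ht h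
        rw [Finset.sum_insert (by simp)]
        simp only [eps, hN, if_false]
        congr 1; ring
      · apply Finset.sum_congr rfl
        intro t ht
        rw [Finset.sum_insert (by simp)]
        have : ∑ k ∈ Finset.range N, eps (insert N t) k * a k = ∑ k ∈ Finset.range N, eps t k * a k := by
          apply Finset.sum_congr rfl
          intro k hk
          have : k ≠ N := by have := Finset.mem_range.1 hk; omega
          simp [eps, this]
        rw [this]
        simp only [eps, Finset.mem_insert_self, if_true]
        congr 1; ring
    have hc : ((Finset.range N).powerset.card : ℝ) = 2^N := by simp
    constructor
    · rw [key (fun x => x^2)]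
      have : ∀ t ∈ (Finset.range N).powerset, ((∑ k ∈ Finset.range N, eps t k * a k - a N)^2 +
            (∑ k ∈ Finset.range N, eps t k * a k + a N)^2) = 2 * (∑ k ∈ Finset.range N, eps t k * a k)^2 + 2 * a N^2 := by
        intros; ring
      rw [Finset.sum_congr rfl this, Finset.sum_add_distrib, ← Finset.mul_sum, h2, Finset.sum_const,
        nsmul_eq_mul, hc, Finset.sum_range_succ]
      ring
    · rw [key (fun x => x^4)]
      have : ∀ t ∈ (Finset.range N).powerset, ((∑ k ∈ Finset.range N, eps t k * a k - a N)^4 +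
            (∑ k ∈ Finset.range N, eps t k * a k + a N)^4) = 2 * (∑ k ∈ Finset.range N, eps t k * a k)^4 +
             (12 * a N^2) * (∑ k ∈ Finset.range N, eps t k * a k)^2 + 2 * a N^4 := by
        intros; ring
      rw [Finset.sum_congr rfl this, Finset.sum_add_distrib, Finset.sum_add_distrib, ← Finset.mul_sum,
        ← Finset.mul_sum, h2, Finset.sum_const, nsmul_eq_mul, hc, Finset.sum_range_succ]
      have : 0 ≤ (2:ℝ)^N * a N^4 := by positivity
      rw [pow_succ (2:ℝ)]
      nlinarith

lemma khin (a : ℕ → ℝ) (N : ℕ) :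
    2^N * √(∑ k ∈ Finset.range N, a k ^2) ≤ 2 * ∑ t ∈ (Finset.range N).powerset, |∑ k ∈ Finset.range N, eps t k * a k| := by
  obtain ⟨h2, h4⟩ := rad_mom a N
  have hs0 : 0 ≤ ∑ k ∈ Finset.range N, a k ^2 := by positivity
  set s := √(∑ k ∈ Finset.range N, a k ^2) with hs
  have hss : ∑ k ∈ Finset.range N, a k ^2 = s^2 := by rw [hs, Real.sq_sqrt hs0]
  rw [hss] at h2 h4
  rcases (Real.sqrt_nonneg (∑ k ∈ Finset.range N, a k ^2)).eq_or_lt with h | h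
  · rw [← hs] at h
    rw [← h]; simp; positivity
  rw [← hs] at h
  have pt : ∀ x : ℝ, 12 * s^2 * x^2 ≤ 16 * s^3 * |x| + x^4 := by
    intro x
    have h1 : 0 ≤ |x| := abs_nonneg x
    rw [← sq_abs x, show x^4 = |x|^4 by rw [← Even.pow_abs (by decide)]]
    have : 0 ≤ |x| * ((|x| - 2*s)^2 * (|x| + 4*s)) := by positivity
    nlinarith
  have := Finset.sum_le_sum (fun t (_ : t ∈ (Finset.range N).powerset) => pt (∑ k ∈ Finset.range N, eps t k * a k))
  rw [Finset.sum_add_distrib, ← Finset.mul_sum, ← Finset.mul_sum, h2] at this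
  have h9 : s^3 * (9 * (2^N * s)) ≤ s^3 * (16 * ∑ t ∈ (Finset.range N).powerset, |∑ k ∈ Finset.range N, eps t k * a k|) := by
    nlinarith
  have := le_of_mul_le_mul_left h9 (by positivity)
  have : 0 ≤ 2^N * s := by positivity
  linarith

abbrev L2 : Type := ↥(lp (fun _ : ℕ => ℝ) 2)

lemma weakNorm_bdd {E : Type} [NormedAddCommGroup E] [NormedSpace ℝ E] (q : ℝ) (hq : 0 < q) {n : ℕ}
    (e : Fin n → E) : BddAbove (Set.range fun f : {f : StrongDual ℝ E // ‖f‖ ≤ 1} =>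
      (∑ i, ‖(f : StrongDual ℝ E) (e i)‖ ^ q) ^ (1 / q)) := by
  refine ⟨(∑ i, ‖e i‖ ^ q) ^ (1 / q), ?_⟩
  rintro _ ⟨f, rfl⟩
  have : ∀ i, ‖(f : StrongDual ℝ E) (e i)‖ ≤ ‖e i‖ := fun i => by
    simpa using f.1.le_of_opNorm_le f.2 (e i)
  dsimp only
  gcongr with i
  exact this i

lemma le_weakNorm {E : Type} [NormedAddCommGroup E] [NormedSpace ℝ E] (q : ℝ) (hq : 0 < q) {n : ℕ}
    (e : Fin n → E) (f : StrongDual ℝ E) (hf : ‖f‖ ≤ 1) :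
    (∑ i, ‖f (e i)‖ ^ q) ^ (1 / q) ≤ weakNorm q e :=
  le_ciSup (weakNorm_bdd q hq e) ⟨f, hf⟩

lemma weakNorm_nonneg' {E : Type} [NormedAddCommGroup E] [NormedSpace ℝ E] (q : ℝ) {n : ℕ}
    (e : Fin n → E) : 0 ≤ weakNorm q e :=
  Real.iSup_nonneg fun f => by positivity

lemma sum_abs_le {E : Type} [NormedAddCommGroup E] [NormedSpace ℝ E] {n : ℕ}
    (e : Fin n → E) (f : StrongDual ℝ E) (B : ℝ) (hB : ‖f‖ ≤ B) :
    ∑ i, |f (e i)| ≤ B * weakNorm 1 e := by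
  have hw := weakNorm_nonneg' 1 e
  refine le_trans ?_ (mul_le_mul_of_nonneg_right hB hw)
  by_cases h : f = 0
  · simp [h]
  have hp : 0 < ‖f‖ := norm_pos_iff.2 h
  have := le_weakNorm 1 one_pos e (‖f‖⁻¹ • f) (by rw [norm_smul]; simp [hp.ne'])
  simp only [ContinuousLinearMap.smul_apply, norm_smul, Real.rpow_one, div_one, norm_inv, norm_norm,
    ← Finset.mul_sum, Real.norm_eq_abs (f _)] at this
  rwa [inv_mul_le_iff₀ hp] at this

lemma l2_hasSum (z : L2) : HasSum (fun k => (z k)^2) (‖z‖^2) := by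
  have := lp.hasSum_norm (p := 2) (by norm_num) z
  simpa using this

lemma l2_sum_le (z : L2) (s : Finset ℕ) : ∑ k ∈ s, (z k)^2 ≤ ‖z‖^2 :=
  sum_le_hasSum s (fun _ _ => sq_nonneg _) (l2_hasSum z)

/-- finite functional -/
def finFun (b : ℕ → ℝ) (N : ℕ) : StrongDual ℝ L2 :=
  ∑ k ∈ Finset.range N, b k • (lp.evalCLM ℝ (fun _ : ℕ => ℝ) (p := 2) k)

lemma finFun_apply (b : ℕ → ℝ) (N : ℕ) (y : L2) :
    finFun b N y = ∑ k ∈ Finset.range N, b k * y k := by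
  simp [finFun, ContinuousLinearMap.sum_apply, lp.evalCLM]

lemma finFun_norm (b : ℕ → ℝ) (N : ℕ) (B : ℝ) (hB : 0 ≤ B)
    (h : ∑ k ∈ Finset.range N, b k ^2 ≤ B^2) : ‖finFun b N‖ ≤ B := by
  refine ContinuousLinearMap.opNorm_le_bound _ hB fun y => ?_
  rw [finFun_apply]
  refine abs_le_of_sq_le_sq ?_ (by positivity)
  refine (Finset.sum_mul_sq_le_sq_mul_sq _ _ _).trans ?_
  rw [mul_pow]
  have := l2_sum_le y (Finset.range N)
  gcongr

lemma diag_sum (d : L2) {n : ℕ} (z y : Fin n → L2) (h : ∀ i k, z i k = d k * y i k) :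
    ∑ i, ‖z i‖ ≤ 2 * ‖d‖ * weakNorm 1 y := by
  have lim : Filter.Tendsto (fun N => ∑ i, √(∑ k ∈ Finset.range N, (z i k)^2)) Filter.atTop
      (nhds (∑ i, ‖z i‖)) := by
    refine tendsto_finset_sum _ fun i _ => ?_
    have := (l2_hasSum (z i)).tendsto_sum_nat.sqrt
    rwa [Real.sqrt_sq (norm_nonneg _)] at this
  refine le_of_tendsto' lim fun N => ?_
  have h1 : ∀ t : Finset ℕ, ∑ i, |∑ k ∈ Finset.range N, eps t k * z i k| ≤ ‖d‖ * weakNorm 1 y := by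
    intro t
    have := sum_abs_le y (finFun (fun k => eps t k * d k) N) ‖d‖
      (finFun_norm _ _ _ (norm_nonneg _) (by
        refine le_trans (le_of_eq (Finset.sum_congr rfl fun k _ => ?_)) (l2_sum_le d (Finset.range N))
        unfold eps; split_ifs <;> ring))
    refine le_trans (le_of_eq ?_) this
    simp only [finFun_apply, h, mul_assoc]
  have h2 : 2^N * ∑ i, √(∑ k ∈ Finset.range N, (z i k)^2) ≤ 2^N * (2 * ‖d‖ * weakNorm 1 y) := by
    rw [Finset.mul_sum]
    calc _ ≤ ∑ i, 2 * ∑ t ∈ (Finset.range N).powerset, |∑ k ∈ Finset.range N, eps t k * z i k| :=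
          Finset.sum_le_sum fun i _ => khin (fun k => z i k) N
      _ = 2 * ∑ t ∈ (Finset.range N).powerset, ∑ i, |∑ k ∈ Finset.range N, eps t k * z i k| := by
          rw [← Finset.mul_sum, Finset.sum_comm]
      _ ≤ 2 * ∑ t ∈ (Finset.range N).powerset, (‖d‖ * weakNorm 1 y) := by
          gcongr with t; exact h1 t
      _ = _ := by
          simp; ring
  exact le_of_mul_le_mul_left h2 (by positivity)

lemma mul_mem (c : L2) (b : ℕ → ℝ) (B : ℝ) (hb : ∀ k, |b k| ≤ B) :
    Memℓp (fun k => c k * b k) 2 := by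
  apply memℓp_gen
  have := ((l2_hasSum c).summable.mul_right (B^2))
  refine Summable.of_nonneg_of_le (fun _ => by positivity) (fun k => ?_) this
  have h := hb k
  simp only [ENNReal.toReal_ofNat, Real.rpow_ofNat, Real.norm_eq_abs, sq_abs, mul_pow]
  have : b k ^2 ≤ B^2 := sq_le_sq' (by linarith [abs_le.1 h]) (abs_le.1 h).2
  gcongr

/-- diagonal entry functional -/
def diagF (k : ℕ) : StrongDual ℝ (EpsTensor L2 L2) :=
  (lp.evalCLM ℝ (fun _ : ℕ => ℝ) (p := 2) k).comp
    ((ContinuousLinearMap.apply ℝ L2 (lp.evalCLM ℝ (fun _ : ℕ => ℝ) (p := 2) k)).comp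
      (epsSub L2 L2).subtypeL)

lemma eval_norm (k : ℕ) : ‖lp.evalCLM ℝ (fun _ : ℕ => ℝ) (p := 2) k‖ ≤ 1 :=
  ContinuousLinearMap.opNorm_le_bound _ zero_le_one fun y => by
    simpa [lp.evalCLM] using lp.norm_apply_le_norm (by norm_num) y k

lemma diagF_norm (k : ℕ) : ‖diagF k‖ ≤ 1 := by
  refine ContinuousLinearMap.opNorm_le_bound _ zero_le_one fun u => ?_
  have h1 := (epsSub L2 L2).subtypeL u |>.le_of_opNorm_le le_rfl (lp.evalCLM ℝ (fun _ : ℕ => ℝ) (p := 2) k)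
  have h2 := (lp.evalCLM ℝ (fun _ : ℕ => ℝ) (p := 2) k).le_of_opNorm_le (eval_norm k)
    ((epsSub L2 L2).subtypeL u (lp.evalCLM ℝ (fun _ : ℕ => ℝ) (p := 2) k))
  have h3 : ‖(epsSub L2 L2).subtypeL u‖ = ‖u‖ := rfl
  rw [h3] at h1
  have h4 := mul_le_mul_of_nonneg_left (eval_norm k) (norm_nonneg u)
  change ‖(lp.evalCLM ℝ (fun _ : ℕ => ℝ) (p := 2) k) ((epsSub L2 L2).subtypeL u (lp.evalCLM ℝ (fun _ : ℕ => ℝ) (p := 2) k))‖ ≤ _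
  linarith

lemma diagF_abs (k : ℕ) (u : EpsTensor L2 L2) : |diagF k u| ≤ ‖u‖ := by
  simpa using (diagF k).le_of_opNorm_le (diagF_norm k) u

lemma diagF_tmul (k : ℕ) (x y : L2) : diagF k (tmulLeft x y) = x k * y k := rfl

/-- the operator -/
def opT (c : L2) : EpsTensor L2 L2 →L[ℝ] L2 :=
  LinearMap.mkContinuous
    { toFun := fun u => (⟨fun k => c k * diagF k u, mul_mem c _ ‖u‖ fun k => diagF_abs k u⟩ : L2)
      map_add' := fun u v => by
        ext k; simp [mul_add]; rfl
      map_smul' := fun a u => by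
        ext k; simp [mul_left_comm] } ‖c‖ (by
    intro u
    refine abs_le_of_sq_le_sq' ?_ (by positivity) |>.2
    refine hasSum_le (fun k => ?_) (l2_hasSum _) (by
      rw [mul_pow]; exact (l2_hasSum c).mul_right (‖u‖^2))
    have h := diagF_abs k u
    have : diagF k u ^2 ≤ ‖u‖^2 := sq_le_sq' (by linarith [abs_le.1 h]) (abs_le.1 h).2
    change (c k * diagF k u)^2 ≤ _
    rw [mul_pow]
    gcongr)

lemma opT_apply (c : L2) (u) (k : ℕ) : opT c u k = c k * diagF k u := rfl

lemma opT_two (c : L2) : IsPSumming 2 (opT c) := by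
  refine ⟨‖c‖, norm_nonneg _, fun n e => ?_⟩
  have hw := weakNorm_nonneg' 2 e
  have key : ∀ k, ∑ i, (diagF k (e i))^2 ≤ (weakNorm 2 e)^2 := by
    intro k
    have := le_weakNorm 2 two_pos e (diagF k) (diagF_norm k)
    rw [← Real.sqrt_eq_rpow] at this
    have := (Real.sqrt_le_left hw).1 this
    simpa using this
  rw [← Real.sqrt_eq_rpow]
  apply Real.sqrt_le_iff.2 ⟨by positivity, ?_⟩
  simp only [Real.rpow_ofNat]
  have h1 : HasSum (fun k => ∑ i, (opT c (e i) k)^2) (∑ i, ‖opT c (e i)‖^2) :=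
    hasSum_sum fun i _ => l2_hasSum _
  refine hasSum_le (fun k => ?_) h1 (by
      rw [mul_pow]; exact (l2_hasSum c).mul_right _)
  simp only [opT_apply, mul_pow, ← Finset.mul_sum]
  have := key k
  gcongr

lemma sharp_summing (c x : L2) (d : L2) (hd : ∀ k, d k = c k * x k) :
    SummingWithC 1 1 (2 * ‖d‖) (sharp (opT c) x) := by
  intro n e
  simp only [Real.rpow_one, div_one]
  refine diag_sum d _ e fun i k => ?_
  rw [hd]
  change opT c (tmulLeft x (e i)) k = _
  rw [opT_apply, diagF_tmul, mul_assoc]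

/-- coordinatewise product -/
def dmul (c x : L2) : L2 :=
  ⟨fun k => c k * x k, mul_mem c _ ‖x‖ fun k => lp.norm_apply_le_norm (by norm_num) x k⟩

/-- the sequence `1/(k+1)` -/
def cseq : L2 := ⟨fun k => 1 / ((k : ℝ) + 1), by
  apply memℓp_gen
  have := (summable_nat_add_iff 1).2 (Real.summable_one_div_nat_pow.2 one_lt_two)
  refine this.congr fun k => ?_
  simp⟩

/-- unit vectors -/
def ev (i : ℕ) : L2 := lp.single 2 i (1:ℝ)

lemma sum_sq_dual (φ : StrongDual ℝ L2) (n : ℕ) : ∑ i : Fin n, (φ (ev i))^2 ≤ ‖φ‖^2 := by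
  set S := ∑ i : Fin n, (φ (ev i))^2 with hS
  have hS0 : 0 ≤ S := by positivity
  set z : L2 := ∑ i : Fin n, φ (ev i) • ev i with hz
  have h1 : φ z = S := by simp [hz, hS, sq]
  have h2 : ‖z‖^2 = S := by
    have := lp.norm_sum_single (p := 2) (E := fun _ : ℕ => ℝ) (by norm_num) (fun i => φ (ev i)) (Finset.range n)
    simp only [ENNReal.toReal_ofNat, Real.rpow_ofNat, Real.norm_eq_abs, sq_abs] at this
    rw [hS, Fin.sum_univ_eq_sum_range (fun i => (φ (ev i))^2) n, ← this, hz,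
      Fin.sum_univ_eq_sum_range (fun i => φ (ev i) • ev i) n]
    congr 2
    refine Finset.sum_congr rfl fun i _ => ?_
    rw [ev, ← lp.single_smul]; simp
  have h3 := φ.le_opNorm z
  rw [h1, Real.norm_eq_abs, abs_of_nonneg hS0] at h3
  have h4 : S^2 ≤ ‖φ‖^2 * S := by
    rw [← h2, ← mul_pow, h2]
    exact pow_le_pow_left₀ hS0 h3 2
  by_contra! hlt
  have : 0 < S := lt_of_le_of_lt (by positivity) hlt
  nlinarith

lemma diag_norm (n : ℕ) (σ : Fin n → ℝ) (hσ : ∀ i, σ i ^2 ≤ 1) :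
    ‖∑ i : Fin n, σ i • (tmulLeft (ev i) (ev i) : EpsTensor L2 L2)‖ ≤ 1 := by
  set u := ∑ i : Fin n, σ i • (tmulLeft (ev i) (ev i) : EpsTensor L2 L2) with hu
  have h3 : ‖u‖ = ‖(epsSub L2 L2).subtypeL u‖ := rfl
  rw [h3]
  refine ContinuousLinearMap.opNorm_le_bound _ zero_le_one fun φ => ?_
  have h4 : (epsSub L2 L2).subtypeL u φ = ∑ i : Fin n, (σ i * φ (ev i)) • ev i := by
    have : (epsSub L2 L2).subtypeL u = ∑ i : Fin n, σ i • elemTensor (ev i) (ev i) := by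
      rw [hu]
      refine (map_sum (epsSub L2 L2).subtypeL _ _).trans ?_
      rfl
    rw [this, ContinuousLinearMap.sum_apply]
    refine Finset.sum_congr rfl fun i _ => ?_
    simp [elemTensor, smul_smul]
  rw [h4, one_mul]
  refine abs_le_of_sq_le_sq' ?_ (by positivity) |>.2
  set τ : ℕ → ℝ := fun i => if h : i < n then σ ⟨i, h⟩ else 0 with hτ
  have hτi : ∀ i : Fin n, σ i = τ i := fun i => by simp [hτ]
  have := lp.norm_sum_single (p := 2) (E := fun _ : ℕ => ℝ) (by norm_num) (fun i => τ i * φ (ev i)) (Finset.range n)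
  simp only [ENNReal.toReal_ofNat, Real.rpow_ofNat, Real.norm_eq_abs, sq_abs] at this
  have h5 : ∑ i : Fin n, (σ i * φ (ev i)) • ev i
      = ∑ i ∈ Finset.range n, lp.single 2 i (τ i * φ (ev i)) := by
    rw [← Fin.sum_univ_eq_sum_range (fun i => (lp.single 2 i (τ i * φ (ev i)) : L2)) n]
    refine Finset.sum_congr rfl fun i _ => ?_
    rw [hτi, ev, ← lp.single_smul]; simp
  rw [h5, this, ← Fin.sum_univ_eq_sum_range (fun i => (τ i * φ (ev i))^2) n]
  refine le_trans (Finset.sum_le_sum fun i _ => ?_) (sum_sq_dual φ n)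
  rw [← hτi, mul_pow]
  exact mul_le_of_le_one_left (sq_nonneg _) (hσ i)

lemma weak_diag (n : ℕ) :
    weakNorm 1 (fun i : Fin n => (tmulLeft (ev i) (ev i) : EpsTensor L2 L2)) ≤ 1 := by
  haveI : Nonempty {f : StrongDual ℝ (EpsTensor L2 L2) // ‖f‖ ≤ 1} := ⟨⟨0, by simp⟩⟩
  refine ciSup_le fun f => ?_
  simp only [Real.rpow_one, div_one]
  have h := f.1.le_of_opNorm_le f.2 (∑ i : Fin n,
    (SignType.sign (f.1 (tmulLeft (ev i) (ev i))) : ℝ) • (tmulLeft (ev i) (ev i) : EpsTensor L2 L2))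
  have h2 := diag_norm n (fun i => (SignType.sign (f.1 (tmulLeft (ev i) (ev i))) : ℝ)) (fun i => by
    rcases lt_trichotomy (f.1 (tmulLeft (ev i) (ev i))) 0 with h | h | h <;> simp [h])
  rw [map_sum] at h
  simp only [map_smul, smul_eq_mul, sign_mul_self] at h
  have h3 := le_abs_self (∑ i : Fin n, |f.1 (tmulLeft (ev i) (ev i))|)
  simp only [Real.norm_eq_abs] at h ⊢
  linarith

lemma opT_not_one : ¬ IsPSumming 1 (opT cseq) := by
  rintro ⟨C, hC, h⟩
  have key : ∀ n : ℕ, ∑ i ∈ Finset.range n, 1 / ((i : ℝ) + 1) ≤ C := by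
    intro n
    have h1 := h n (fun i : Fin n => tmulLeft (ev i) (ev i))
    simp only [Real.rpow_one, div_one] at h1
    have h2 := mul_le_mul_of_nonneg_left (weak_diag n) hC
    rw [← Fin.sum_univ_eq_sum_range (fun i => 1 / ((i : ℝ) + 1)) n]
    refine le_trans (Finset.sum_le_sum fun i _ => ?_) (h1.trans (h2.trans (mul_one C).le))
    have h3 := lp.norm_apply_le_norm (by norm_num) (opT cseq (tmulLeft (ev i) (ev i))) (i : ℕ)
    rw [opT_apply, diagF_tmul] at h3
    have h4 : ev (i : ℕ) (i : ℕ) = 1 := lp.single_apply_self 2 _ _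
    rw [h4, mul_one, mul_one] at h3
    exact (le_abs_self _).trans h3
  obtain ⟨n, hn⟩ := (Real.tendsto_sum_range_one_div_nat_succ_atTop.eventually_gt_atTop C).exists
  exact absurd (key n) (not_le.2 hn)

/-- Theorem 8: there exists a bounded linear operator
`T : ℓ₂ ⊗̂_ε ℓ₂ → ℓ₂` which is 2-summing but not 1-summing, and whose associated operator
`T# : ℓ₂ → Π₁(ℓ₂, ℓ₂)` is 1-summing (i.e. every `T# x : ℓ₂ → ℓ₂` is 1-summing and
`Σ_i π₁(T# x_i) ≤ C · sup { Σ_i |x*(x_i)| : ‖x*‖ ≤ 1 }` for all finite families in `ℓ₂`). -/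
theorem statement10 :
    ∃ T : EpsTensor ↥(lp (fun _ : ℕ => ℝ) 2) ↥(lp (fun _ : ℕ => ℝ) 2) →L[ℝ]
        ↥(lp (fun _ : ℕ => ℝ) 2),
      IsPSumming 2 T ∧
      ¬ IsPSumming 1 T ∧
      (∀ x : ↥(lp (fun _ : ℕ => ℝ) 2), IsPSumming 1 (sharp T x)) ∧
      ∃ C, 0 ≤ C ∧ ∀ (n : ℕ) (v : Fin n → ↥(lp (fun _ : ℕ => ℝ) 2)),
        ∑ i, pNorm 1 (sharp T (v i)) ≤ C * weakNorm 1 v := by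
  refine ⟨opT cseq, opT_two _, opT_not_one, fun x => ?_, 2 * (2 * ‖cseq‖), by positivity, fun n v => ?_⟩
  · exact ⟨2 * ‖dmul cseq x‖, by positivity, sharp_summing cseq x _ fun k => rfl⟩
  · have h1 : ∀ i, pNorm 1 (sharp (opT cseq) (v i)) ≤ 2 * ‖dmul cseq (v i)‖ := fun i =>
      csInf_le ⟨0, fun _ h => h.1⟩ ⟨by positivity, sharp_summing cseq (v i) _ fun k => rfl⟩
    have h2 := diag_sum cseq (fun i => dmul cseq (v i)) v fun i k => rfl
    refine (Finset.sum_le_sum fun i _ => h1 i).trans ?_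
    rw [← Finset.mul_sum]
    linarith
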